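/- Let X be a measurable space and let Q : ℱ(𝒯(X)) → [0,1] be weakly averaging, affine, and limit-preserving. For each f ∈ ℱ(X) the evaluation map ev_f : 𝒯(X) → [0,1], G ↦ G(f), belongs to ℱ(𝒯(X)), and the functional μ_X(Q) : ℱ(X) → [0,1] defined by μ_X(Q)(f) = Q(ev_f) is weakly averaging, affine, and limit-preserving. -/

import Mathlib

open MeasureTheory Set Filter

/-- `f : Z → ℝ` represents an element of `ℱ(Z)`: a measurable function with values in `[0,1]`. -/
def IsUF {Z : Type*} [MeasurableSpace Z] (f : Z → ℝ) : Prop :=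
  Measurable f ∧ ∀ z, f z ∈ Set.Icc (0 : ℝ) 1

/-- `ℱ(Z)`, the space of measurable functions `Z → [0,1]`.  As a subtype of `Z → ℝ`
(with its product σ-algebra) it carries the σ-algebra generated by the point
evaluation maps `f ↦ f z`, `z : Z`. -/
abbrev UF (Z : Type*) [MeasurableSpace Z] : Type _ := {f : Z → ℝ // IsUF f}

/-- The constant function with value `c ∈ [0,1]`, as an element of `ℱ(Z)`. -/
def constUF {Z : Type*} [MeasurableSpace Z] (c : ℝ) (hc : c ∈ Set.Icc (0 : ℝ) 1) : UF Z :=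
  ⟨fun _ => c, measurable_const, fun _ => hc⟩

/-- The pointwise convex combination `α·f + (1-α)·g` of `f, g ∈ ℱ(Z)`. -/
noncomputable def convComb {Z : Type*} [MeasurableSpace Z] (α : ℝ) (hα : α ∈ Set.Icc (0 : ℝ) 1)
    (f g : UF Z) : UF Z :=
  ⟨fun z => α * f.1 z + (1 - α) * g.1 z, by
    refine ⟨(f.2.1.const_mul α).add (g.2.1.const_mul (1 - α)), fun z => ⟨?_, ?_⟩⟩ <;> dsimp only <;>
      nlinarith [hα.1, hα.2, (f.2.2 z).1, (f.2.2 z).2, (g.2.2 z).1, (g.2.2 z).2]⟩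

/-- The characteristic function `χ_S ∈ ℱ(Z)` of a measurable set `S`. -/
noncomputable def chi {Z : Type*} [MeasurableSpace Z] (S : Set Z) (hS : MeasurableSet S) : UF Z :=
  ⟨S.indicator fun _ => (1 : ℝ), by
    refine ⟨measurable_const.indicator hS, fun z => ?_⟩
    by_cases h : z ∈ S <;> simp [h]⟩

/-- A functional `G : ℱ(Z) → [0,1]` is weakly averaging if it sends each constant function
with value `c ∈ [0,1]` to `c`. -/
def WeaklyAveraging {Z : Type*} [MeasurableSpace Z] (G : UF Z → ℝ) : Prop :=
  ∀ (c : ℝ) (hc : c ∈ Set.Icc (0 : ℝ) 1), G (constUF c hc) = c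

/-- A functional `G : ℱ(Z) → [0,1]` is affine if it preserves (pointwise) convex
combinations. -/
def IsAffineFunctional {Z : Type*} [MeasurableSpace Z] (G : UF Z → ℝ) : Prop :=
  ∀ (f g : UF Z) (α : ℝ) (hα : α ∈ Set.Icc (0 : ℝ) 1),
    G (convComb α hα f g) = α * G f + (1 - α) * G g

/-- A functional `G : ℱ(Z) → [0,1]` preserves limits if on each `f ∈ ℱ(Z)` its value is
the supremum of its values on simple (finite range) members of `ℱ(Z)` below `f`. -/
def PreservesLimitsFunctional {Z : Type*} [MeasurableSpace Z] (G : UF Z → ℝ) : Prop :=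
  ∀ f : UF Z, G f = sSup {r : ℝ | ∃ ψ : UF Z,
    (Set.range ψ.1).Finite ∧ (∀ z, ψ.1 z ≤ f.1 z) ∧ G ψ = r}

/-- `𝒯(Z)`: the space of measurable, weakly averaging, affine, limit-preserving
functionals `ℱ(Z) → [0,1]`.  As a subtype of `ℱ(Z) → ℝ` (with its product σ-algebra)
it carries the σ-algebra generated by the evaluation maps `G ↦ G f`, `f ∈ ℱ(Z)`. -/
abbrev TT (Z : Type*) [MeasurableSpace Z] : Type _ :=
  {G : UF Z → ℝ // Measurable G ∧ (∀ f, G f ∈ Set.Icc (0 : ℝ) 1) ∧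
    WeaklyAveraging G ∧ IsAffineFunctional G ∧ PreservesLimitsFunctional G}

/-- For `f ∈ ℱ(X)`, the evaluation map `ev_f : 𝒯(X) → [0,1]`, `G ↦ G(f)`, belongs to
`ℱ(𝒯(X))`: it is measurable and takes values in `[0,1]`. -/
lemma evalUF {X : Type*} [MeasurableSpace X] (f : UF X) :
    IsUF (fun G : TT X => G.1 f) :=
  ⟨(measurable_pi_apply f).comp measurable_subtype_coe, fun G => G.2.2.1 f⟩

namespace IsAffineFunctional

variable {Z : Type*} [MeasurableSpace Z] {G : UF Z → ℝ}

lemma map_eq_add (hA : IsAffineFunctional G) (hW : WeaklyAveraging G) {f g h : UF Z}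
    (hfg : ∀ z, h.1 z = f.1 z + g.1 z) : G h = G f + G g := by
  have half : (1 / 2 : ℝ) ∈ Set.Icc (0 : ℝ) 1 := by norm_num
  have zero : (0 : ℝ) ∈ Set.Icc (0 : ℝ) 1 := by norm_num
  have heq : convComb (1 / 2) half f g = convComb (1 / 2) half h (constUF 0 zero) := by
    apply Subtype.ext
    funext z
    simp only [convComb, constUF, hfg z]
    ring
  have key := congrArg G heq
  rw [hA, hA, hW] at key
  linarith

lemma map_mono (hA : IsAffineFunctional G) (hW : WeaklyAveraging G) (h0 : ∀ f, 0 ≤ G f)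
    {f g : UF Z} (hfg : ∀ z, f.1 z ≤ g.1 z) : G f ≤ G g := by
  let d : UF Z := ⟨fun z => g.1 z - f.1 z, g.2.1.sub f.2.1, fun z =>
    ⟨sub_nonneg.2 (hfg z), by linarith [(g.2.2 z).2, (f.2.2 z).1]⟩⟩
  have := hA.map_eq_add hW (f := f) (g := d) (h := g) fun z => by simp [d]
  linarith [h0 d]

end IsAffineFunctional

lemma UF.exists_simple_le {Z : Type*} [MeasurableSpace Z] (f : UF Z) (n : ℕ) :
    ∃ ψ : UF Z, (Set.range ψ.1).Finite ∧ (∀ z, ψ.1 z ≤ f.1 z) ∧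
      ∀ z, f.1 z ≤ ψ.1 z + 1 / ((n : ℝ) + 1) := by
  have hn : (0 : ℝ) < (n : ℝ) + 1 := by positivity
  have hle : ∀ z, (⌊f.1 z * ((n : ℝ) + 1)⌋₊ : ℝ) / ((n : ℝ) + 1) ≤ f.1 z := fun z =>
    (div_le_iff₀ hn).2 (Nat.floor_le (mul_nonneg (f.2.2 z).1 hn.le))
  refine ⟨⟨fun z => (⌊f.1 z * ((n : ℝ) + 1)⌋₊ : ℝ) / ((n : ℝ) + 1), ?_, fun z =>
    ⟨by positivity, (hle z).trans (f.2.2 z).2⟩⟩, ?_, hle, fun z => ?_⟩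
  · have := f.2.1
    fun_prop
  · refine ((Set.finite_Iic (n + 1)).image fun k : ℕ => (k : ℝ) / ((n : ℝ) + 1)).subset ?_
    rintro _ ⟨z, rfl⟩
    refine ⟨_, Nat.floor_le_of_le ?_, rfl⟩
    push_cast
    nlinarith [(f.2.2 z).2]
  · rw [← add_div, le_div_iff₀ hn]
    exact (Nat.lt_floor_add_one _).le

/-- Limit preservation is automatic, since every `f ∈ ℱ(Z)` is a uniform limit of simple functions
from below. -/
lemma IsAffineFunctional.preservesLimits {Z : Type*} [MeasurableSpace Z] {G : UF Z → ℝ}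
    (hA : IsAffineFunctional G) (hW : WeaklyAveraging G) (h0 : ∀ f, 0 ≤ G f) :
    PreservesLimitsFunctional G := by
  intro f
  have hlub : IsLUB {r : ℝ | ∃ ψ : UF Z,
      (Set.range ψ.1).Finite ∧ (∀ z, ψ.1 z ≤ f.1 z) ∧ G ψ = r} (G f) := by
    refine ⟨?_, fun b hb => le_of_forall_pos_le_add fun ε hε => ?_⟩
    · rintro _ ⟨ψ, -, hψ, rfl⟩
      exact hA.map_mono hW h0 hψ
    · obtain ⟨n, hn⟩ := exists_nat_one_div_lt hε
      obtain ⟨ψ, hfin, hψ, hlt⟩ := f.exists_simple_le n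
      have hc : 1 / ((n : ℝ) + 1) ∈ Set.Icc (0 : ℝ) 1 :=
        ⟨by positivity, (div_le_one (by positivity)).2 (by linarith [n.cast_nonneg (α := ℝ)])⟩
      let d : UF Z := ⟨fun z => f.1 z - ψ.1 z, f.2.1.sub ψ.2.1, fun z =>
        ⟨sub_nonneg.2 (hψ z), by linarith [(f.2.2 z).2, (ψ.2.2 z).1]⟩⟩
      have hadd : G f = G ψ + G d := hA.map_eq_add hW fun z => by simp [d]
      have hd : G d ≤ G (constUF _ hc) :=
        hA.map_mono hW h0 fun z => by simpa only [d, constUF] using sub_le_iff_le_add'.2 (hlt z)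
      rw [hW] at hd
      linarith [hb ⟨ψ, hfin, hψ, rfl⟩]
  exact (hlub.csSup_eq ⟨_, constUF 0 (by norm_num), Set.finite_range_const,
    fun z => (f.2.2 z).1, rfl⟩).symm

/-- for `Q : ℱ(𝒯(X)) → [0,1]` weakly averaging, affine and
limit-preserving, each evaluation map `ev_f : G ↦ G(f)` belongs to `ℱ(𝒯(X))`, and the
functional `μ_X(Q) : ℱ(X) → [0,1]`, `f ↦ Q(ev_f)`, is weakly averaging, affine and
limit-preserving. -/
theorem multiplication_functional_properties
    {X : Type*} [MeasurableSpace X] (Q : UF (TT X) → ℝ)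
    (hQ01 : ∀ g, Q g ∈ Set.Icc (0 : ℝ) 1)
    (hWA : WeaklyAveraging Q) (hAff : IsAffineFunctional Q)
    (hPL : PreservesLimitsFunctional Q) :
    (∀ f : UF X, IsUF (fun G : TT X => G.1 f)) ∧
    WeaklyAveraging (fun f : UF X => Q ⟨fun G : TT X => G.1 f, evalUF f⟩) ∧
    IsAffineFunctional (fun f : UF X => Q ⟨fun G : TT X => G.1 f, evalUF f⟩) ∧
    PreservesLimitsFunctional (fun f : UF X => Q ⟨fun G : TT X => G.1 f, evalUF f⟩) := by
  have hW : WeaklyAveraging (fun f : UF X => Q ⟨fun G : TT X => G.1 f, evalUF f⟩) := by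
    intro c hc
    exact (congrArg Q (Subtype.ext (funext fun G => G.2.2.2.1 c hc))).trans (hWA c hc)
  have hA : IsAffineFunctional (fun f : UF X => Q ⟨fun G : TT X => G.1 f, evalUF f⟩) := by
    intro f g α hα
    refine Eq.trans (congrArg Q (Subtype.ext (funext fun G => ?_))) (hAff _ _ α hα)
    exact G.2.2.2.2.1 f g α hα
  exact ⟨evalUF, hW, hA, hA.preservesLimits hW fun _ => (hQ01 _).1⟩
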